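/- Let r ≥ 5 and ε > 0. If n is sufficiently large, then there exists a good K_r-chain H_1, …, H_T with T = ⌊n^{2 − α_r − ε}⌋ sets, where α_r = (r−2)/(C(r,2)−2), using at most n vertices in total. -/

import Mathlib

/-- `H 1, …, H t` is a `K_r`-chain: each `H i` is a set of `r` vertices (spanning a complete
graph), and for `i < j` the cliques `H i` and `H j` are edge-disjoint (share at most one
vertex) unless `j = i + 1`, in which case they share exactly one edge (exactly two
vertices). -/
def IsKrChain {n : ℕ} (r t : ℕ) (H : ℕ → Finset (Fin n)) : Prop :=
  (∀ i, 1 ≤ i → i ≤ t → (H i).card = r) ∧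
  (∀ i j, 1 ≤ i → i < j → j ≤ t →
    (j = i + 1 → (H i ∩ H j).card = 2) ∧ (j ≠ i + 1 → (H i ∩ H j).card ≤ 1))

/-- The chain `H 1, …, H t` has an external `K_r^-`: there is an `r`-set `B`, not equal to
any `H i`, and a pair `x ≠ y` in `B`, such that every edge within `B` other than (possibly)
`xy` lies inside some `H i`; i.e. the union `⋃ H i` contains a copy of `K_r` minus an edge
not contained in any individual `H i`. -/
def HasExternalKrMinus {n : ℕ} (r t : ℕ) (H : ℕ → Finset (Fin n)) : Prop :=
  ∃ B : Finset (Fin n), B.card = r ∧ (∀ i, 1 ≤ i → i ≤ t → B ≠ H i) ∧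
    ∃ x ∈ B, ∃ y ∈ B, x ≠ y ∧
      ∀ u ∈ B, ∀ v ∈ B, u ≠ v → ¬((u = x ∧ v = y) ∨ (u = y ∧ v = x)) →
        ∃ i, 1 ≤ i ∧ i ≤ t ∧ u ∈ H i ∧ v ∈ H i

/-- A `K_r`-chain is good if it generates no external `K_r^-`. -/
def IsGoodKrChain {n : ℕ} (r t : ℕ) (H : ℕ → Finset (Fin n)) : Prop :=
  IsKrChain r t H ∧ ¬ HasExternalKrMinus r t H


section LLL
variable {V : Type*} [Fintype V] [DecidableEq V]

def eSupp (E : Finset (V × V)) : Finset V := E.image Prod.fst ∪ E.image Prod.snd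

open Classical in
noncomputable def goodSet (N : ℕ) (F : Finset (Finset (V × V))) (S : Finset V) :
    Finset (V → Fin N) :=
  Finset.univ.filter (fun x => ∀ E ∈ F, eSupp E ⊆ S → ∃ e ∈ E, x e.1 ≠ x e.2)

lemma mem_goodSet {N : ℕ} {F : Finset (Finset (V × V))} {S : Finset V} {x : V → Fin N} :
    x ∈ goodSet N F S ↔ ∀ E ∈ F, eSupp E ⊆ S → ∃ e ∈ E, x e.1 ≠ x e.2 := by
  simp [goodSet]

lemma goodSet_anti {N : ℕ} {F : Finset (Finset (V × V))} {S S' : Finset V} (h : S ⊆ S') :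
    goodSet N F S' ⊆ goodSet N F S := by
  intro x hx
  rw [mem_goodSet] at *
  exact fun E hE hs => hx E hE (hs.trans h)

open Classical in
lemma count_bad (N : ℕ) (F : Finset (Finset (V × V))) (S : Finset V) (E : Finset (V × V))
    (hinj : Set.InjOn Prod.fst (E : Set (V × V)))
    (hdis : ∀ e ∈ E, ∀ e' ∈ E, e.1 ≠ e'.2) :
    ((goodSet N F S).filter (fun x => ∀ e ∈ E, x e.1 = x e.2)).card * N ^ E.card
      ≤ (goodSet N F (S \ E.image Prod.fst)).card := by
  set D := E.image Prod.fst with hD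
  have hc : N ^ E.card = (Finset.univ : Finset (D → Fin N)).card := by
    rw [Finset.card_univ, Fintype.card_fun, Fintype.card_fin, Fintype.card_coe, hD,
      Finset.card_image_of_injOn hinj]
  rw [hc, ← Finset.card_product]
  apply Finset.card_le_card_of_injOn
    (fun p => fun v => if h : v ∈ D then p.2 ⟨v, h⟩ else p.1 v)
  · rintro ⟨x, y⟩ hxy
    simp only [Finset.coe_product, Set.mem_prod, Finset.mem_coe, Finset.mem_filter] at hxy
    obtain ⟨⟨hx, -⟩, -⟩ := hxy
    simp only [Finset.mem_coe]
    rw [mem_goodSet] at *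
    intro E' hE' hs
    obtain ⟨e, he, hne⟩ := hx E' hE' (hs.trans Finset.sdiff_subset)
    refine ⟨e, he, ?_⟩
    have h1 : e.1 ∈ S \ D := hs (Finset.mem_union_left _ (Finset.mem_image_of_mem _ he))
    have h2 : e.2 ∈ S \ D := hs (Finset.mem_union_right _ (Finset.mem_image_of_mem _ he))
    rw [Finset.mem_sdiff] at h1 h2
    simp only [h1.2, h2.2, dite_false]
    exact hne
  · rintro ⟨x, y⟩ hxy ⟨x', y'⟩ hxy' heq
    simp only [Finset.coe_product, Set.mem_prod, Finset.mem_coe, Finset.mem_filter] at hxy hxy'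
    obtain ⟨⟨-, hx⟩, -⟩ := hxy
    obtain ⟨⟨-, hx'⟩, -⟩ := hxy'
    have hoff : ∀ v, v ∉ D → x v = x' v := by
      intro v hv
      have := congrFun heq v
      simpa [hv] using this
    have hy : y = y' := by
      funext ⟨v, hv⟩
      have := congrFun heq v
      simpa [hv] using this
    have hxx : x = x' := by
      funext v
      by_cases hv : v ∈ D
      · rw [hD, Finset.mem_image] at hv
        obtain ⟨e, he, rfl⟩ := hv
        rw [hx e he, hx' e he]
        apply hoff
        rw [hD, Finset.mem_image]
        rintro ⟨e', he', h⟩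
        exact hdis e' he' e he h
      · exact hoff v hv
    rw [hxx, hy]

open Classical in
lemma lll_step (N : ℕ) (hN : 0 < N) (F : Finset (Finset (V × V)))
    (hinj : ∀ E ∈ F, Set.InjOn Prod.fst (E : Set (V × V)))
    (hdis : ∀ E ∈ F, ∀ e ∈ E, ∀ e' ∈ E, e.1 ≠ e'.2)
    (hsum : ∀ q, ∑ E ∈ F.filter (fun E => q ∈ eSupp E), (2 / (N : ℝ)) ^ E.card ≤ 1 / 2) :
    ∀ k : ℕ, ∀ S : Finset V, S.card = k → ∀ q, q ∉ S →
      ((goodSet N F S).card : ℝ) ≤ 2 * (goodSet N F (insert q S)).card := by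
  intro k
  induction k using Nat.strong_induction_on with
  | _ k ih =>
  intro S hS q hq
  -- removing D costs at most a factor 2^|D|
  have hrem : ∀ D : Finset V, ((goodSet N F (S \ D)).card : ℝ) ≤
      2 ^ D.card * (goodSet N F S).card := by
    intro D
    induction D using Finset.induction_on with
    | empty => simp
    | insert a D ha ihD =>
      rw [Finset.card_insert_of_notMem ha, pow_succ]
      have hg : (0:ℝ) ≤ 2 ^ D.card * (goodSet N F S).card := by positivity
      by_cases haS : a ∈ S
      · have h1 : insert a (S \ insert a D) = S \ D := by
          ext v
          simp only [Finset.mem_insert, Finset.mem_sdiff]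
          by_cases hva : v = a
          · subst hva; simp [haS, ha]
          · simp [hva]
        have h2 : (S \ insert a D).card < k := by
          rw [← hS]
          apply Finset.card_lt_card
          refine ⟨Finset.sdiff_subset, fun h => ?_⟩
          have := h haS
          simp at this
        have h3 := ih _ h2 (S \ insert a D) rfl a (by simp)
        rw [h1] at h3
        linarith
      · have h1 : S \ insert a D = S \ D := by
          ext v
          simp only [Finset.mem_insert, Finset.mem_sdiff]
          by_cases hva : v = a
          · subst hva; simp [haS]
          · simp [hva]
        rw [h1]
        linarith
  have hNr : (0:ℝ) < N := by exact_mod_cast hN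
  have hbad : ∀ E ∈ F, (((goodSet N F S).filter (fun x => ∀ e ∈ E, x e.1 = x e.2)).card : ℝ) ≤
      (2 / (N:ℝ)) ^ E.card * (goodSet N F S).card := by
    intro E hE
    have h1 := count_bad N F S E (hinj E hE) (hdis E hE)
    have h2 := hrem (E.image Prod.fst)
    rw [Finset.card_image_of_injOn (hinj E hE)] at h2
    have h1' : (((goodSet N F S).filter (fun x => ∀ e ∈ E, x e.1 = x e.2)).card : ℝ)
      * (N:ℝ) ^ E.card ≤ 2 ^ E.card * (goodSet N F S).card := by
      refine le_trans ?_ h2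
      exact_mod_cast h1
    rw [div_pow, div_mul_eq_mul_div, le_div_iff₀ (by positivity)]
    exact h1'
  have hsub : goodSet N F S ⊆ goodSet N F (insert q S) ∪
      (F.filter (fun E => q ∈ eSupp E)).biUnion
        (fun E => (goodSet N F S).filter (fun x => ∀ e ∈ E, x e.1 = x e.2)) := by
    intro x hx
    by_cases hxq : x ∈ goodSet N F (insert q S)
    · exact Finset.mem_union_left _ hxq
    · apply Finset.mem_union_right
      rw [mem_goodSet] at hxq
      push Not at hxq
      obtain ⟨E, hE, hs, hall⟩ := hxq
      rw [Finset.mem_biUnion]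
      refine ⟨E, ?_, Finset.mem_filter.2 ⟨hx, hall⟩⟩
      rw [Finset.mem_filter]
      refine ⟨hE, ?_⟩
      by_contra hqE
      have hs' : eSupp E ⊆ S := by
        intro v hv
        rcases Finset.mem_insert.1 (hs hv) with h | h
        · subst h; exact absurd hv hqE
        · exact h
      obtain ⟨e, he, hne⟩ := mem_goodSet.1 hx E hE hs'
      exact hne (hall e he)
  have hcard : ((goodSet N F S).card : ℝ) ≤ (goodSet N F (insert q S)).card +
      ∑ E ∈ F.filter (fun E => q ∈ eSupp E),
        (((goodSet N F S).filter (fun x => ∀ e ∈ E, x e.1 = x e.2)).card : ℝ) := by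
    have := (Finset.card_le_card hsub).trans ((Finset.card_union_le _ _).trans
      (Nat.add_le_add_left Finset.card_biUnion_le _))
    exact_mod_cast this
  have hs2 : ∑ E ∈ F.filter (fun E => q ∈ eSupp E),
        (((goodSet N F S).filter (fun x => ∀ e ∈ E, x e.1 = x e.2)).card : ℝ) ≤
        (1/2) * (goodSet N F S).card := by
    calc _ ≤ ∑ E ∈ F.filter (fun E => q ∈ eSupp E),
          (2 / (N:ℝ)) ^ E.card * (goodSet N F S).card := by
          apply Finset.sum_le_sum
          intro E hE
          exact hbad E (Finset.mem_filter.1 hE).1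
      _ = (∑ E ∈ F.filter (fun E => q ∈ eSupp E),
          (2 / (N:ℝ)) ^ E.card) * (goodSet N F S).card := by rw [Finset.sum_mul]
      _ ≤ _ := by
          apply mul_le_mul_of_nonneg_right (hsum q) (by positivity)
  linarith

open Classical in
lemma lll (N : ℕ) (hN : 0 < N) (F : Finset (Finset (V × V)))
    (hne : ∀ E ∈ F, E.Nonempty)
    (hinj : ∀ E ∈ F, Set.InjOn Prod.fst (E : Set (V × V)))
    (hdis : ∀ E ∈ F, ∀ e ∈ E, ∀ e' ∈ E, e.1 ≠ e'.2)
    (hsum : ∀ q, ∑ E ∈ F.filter (fun E => q ∈ eSupp E), (2 / (N : ℝ)) ^ E.card ≤ 1 / 2) :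
    ∃ x : V → Fin N, ∀ E ∈ F, ∃ e ∈ E, x e.1 ≠ x e.2 := by
  have hpos : ∀ S : Finset V, 0 < ((goodSet N F S).card : ℝ) := by
    intro S
    induction S using Finset.induction_on with
    | empty =>
      have : (fun _ => ⟨0, hN⟩ : V → Fin N) ∈ goodSet N F ∅ := by
        rw [mem_goodSet]
        intro E hE hs
        obtain ⟨e, he⟩ := hne E hE
        have := hs (Finset.mem_union_left _ (Finset.mem_image_of_mem Prod.fst he))
        simp at this
      exact_mod_cast Finset.card_pos.2 ⟨_, this⟩
    | insert a S ha ih =>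
      have := lll_step N hN F hinj hdis hsum _ S rfl a ha
      linarith
  have h := hpos Finset.univ
  have h' : 0 < (goodSet N F Finset.univ).card := by exact_mod_cast h
  obtain ⟨x, hx⟩ := Finset.card_pos.1 h'
  exact ⟨x, fun E hE => mem_goodSet.1 hx E hE (Finset.subset_univ _)⟩

end LLL

lemma analytic_bound (β : ℝ) (K : ℕ) (C B : ℝ) (hB : 0 ≤ B) :
    ∃ n₀ : ℕ, ∀ n : ℕ, n₀ ≤ n → ∀ Q : ℝ, 0 ≤ Q → Q ≤ C * (n : ℝ) ^ β →
      ∀ c < K, ∀ d ≤ K, (c : ℝ) * β < d →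
        B * Q ^ c * (2 / (n : ℝ)) ^ d ≤ 1 / (2 * (K + 1) ^ 2) := by
  have key : ∀ c d : ℕ, (c : ℝ) * β < d → ∀ᶠ n : ℕ in Filter.atTop,
      B * (C * (n : ℝ) ^ β) ^ c * (2 / (n : ℝ)) ^ d ≤ 1 / (2 * (K + 1) ^ 2) := by
    intro c d h
    have h1 : Filter.Tendsto (fun n : ℕ => (B * C ^ c * 2 ^ d) * (n : ℝ) ^ (-((d : ℝ) - c * β)))
        Filter.atTop (nhds ((B * C ^ c * 2 ^ d) * 0)) :=
      (((tendsto_rpow_neg_atTop (by linarith)).comp tendsto_natCast_atTop_atTop)).const_mul _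
    rw [mul_zero] at h1
    have h2 := h1.eventually (ge_mem_nhds (show (0:ℝ) < 1 / (2 * (K + 1) ^ 2) by positivity))
    filter_upwards [h2, Filter.eventually_gt_atTop 0] with n hn hn0
    refine le_trans (le_of_eq ?_) hn
    have hn' : (0:ℝ) < n := by exact_mod_cast hn0
    rw [mul_pow, div_pow, neg_sub, Real.rpow_sub hn', Real.rpow_natCast, mul_comm (c:ℝ) β,
      Real.rpow_mul hn'.le, Real.rpow_natCast]
    field_simp
  have hall : ∀ᶠ n : ℕ in Filter.atTop, ∀ c ∈ Finset.range K, ∀ d ∈ Finset.range (K+1),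
      (c : ℝ) * β < d →
      B * (C * (n : ℝ) ^ β) ^ c * (2 / (n : ℝ)) ^ d ≤ 1 / (2 * (K + 1) ^ 2) := by
    rw [Filter.eventually_all_finset]
    intro c _
    rw [Filter.eventually_all_finset]
    intro d _
    by_cases h : (c : ℝ) * β < d
    · filter_upwards [key c d h] with n hn _ using hn
    · exact Filter.Eventually.of_forall fun n h' => absurd h' h
  obtain ⟨n₀, hn₀⟩ := Filter.eventually_atTop.1 hall
  refine ⟨n₀, fun n hn Q hQ0 hQ c hc d hd h => ?_⟩
  refine le_trans ?_ (hn₀ n hn c (Finset.mem_range.2 hc) d (Finset.mem_range.2 (by omega)) h)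
  gcongr

lemma cluster (L : ℕ) (P : Finset ℕ) : ∃ κ : ℕ → ℕ,
    (∀ p ∈ P, κ p ∈ P ∧ κ p ≤ p ∧ p ≤ κ p + L * P.card) ∧
    (∀ p ∈ P, ∀ q ∈ P, p ≤ q → q ≤ p + L → κ p = κ q) := by
  induction P using Finset.induction_on_max with
  | empty => exact ⟨id, by simp, by simp⟩
  | insert m P hm ih =>
    obtain ⟨κ, h1, h2⟩ := ih
    have hmP : m ∉ P := fun h => lt_irrefl _ (hm m h)
    rw [Finset.card_insert_of_notMem hmP]
    by_cases hex : ∃ p ∈ P, m ≤ p + L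
    · obtain ⟨p₀, hp₀, hmp₀⟩ := hex
      refine ⟨fun p => if p = m then κ p₀ else κ p, ?_, ?_⟩
      · intro p hp
        rcases Finset.mem_insert.1 hp with rfl | hp
        · have := h1 p₀ hp₀
          have := hm p₀ hp₀
          simp only [if_true]
          refine ⟨Finset.mem_insert_of_mem (h1 p₀ hp₀).1, by omega, ?_⟩
          rw [Nat.mul_succ]; omega
        · have hlt := hm p hp
          have := h1 p hp
          simp only [hlt.ne, if_false]
          refine ⟨Finset.mem_insert_of_mem this.1, this.2.1, ?_⟩
          rw [Nat.mul_succ]; omega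
      · have key : ∀ p ∈ P, m ≤ p + L → κ p = κ p₀ := by
          intro p hp hpm
          have := hm p hp
          have := hm p₀ hp₀
          rcases le_total p p₀ with h | h
          · exact h2 p hp p₀ hp₀ h (by omega)
          · exact (h2 p₀ hp₀ p hp h (by omega)).symm
        intro p hp q hq hpq hqL
        rcases Finset.mem_insert.1 hp with rfl | hp <;> rcases Finset.mem_insert.1 hq with rfl | hq
        · rfl
        · have := hm q hq; omega
        · rename_i hp'
          simp only [(hm p hp').ne, if_false, if_true]
          exact key p hp' hqL
        · simp only [(hm p hp).ne, (hm q hq).ne, if_false]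
          exact h2 p hp q hq hpq hqL
    · push Not at hex
      refine ⟨fun p => if p = m then m else κ p, ?_, ?_⟩
      · intro p hp
        rcases Finset.mem_insert.1 hp with rfl | hp
        · simp
        · have hlt := hm p hp
          have := h1 p hp
          simp only [hlt.ne, if_false]
          refine ⟨Finset.mem_insert_of_mem this.1, this.2.1, ?_⟩
          rw [Nat.mul_succ]; omega
      · intro p hp q hq hpq hqL
        rcases Finset.mem_insert.1 hp with rfl | hp <;> rcases Finset.mem_insert.1 hq with rfl | hq
        · rfl
        · have := hm q hq; omega
        · rename_i hp'
          have := hex p hp'; omega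
        · simp only [(hm p hp).ne, (hm q hq).ne, if_false]
          exact h2 p hp q hq hpq hqL

noncomputable def alphaR (r : ℕ) : ℝ := ((r : ℝ) - 2) / ((r.choose 2 : ℝ) - 2)

lemma alphaR_eq (r : ℕ) (hr : 5 ≤ r) :
    alphaR r * ((r:ℝ) * (r - 1) - 4) = 2 * (r - 2) := by
  have h5 : (5:ℝ) ≤ r := by exact_mod_cast hr
  unfold alphaR
  rw [Nat.cast_choose_two]
  have : (r:ℝ) * (r - 1) / 2 - 2 ≠ 0 := by nlinarith
  rw [div_mul_eq_mul_div, div_eq_iff this]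
  ring

lemma alphaR_pos (r : ℕ) (hr : 5 ≤ r) : 0 < alphaR r := by
  have h5 : (5:ℝ) ≤ r := by exact_mod_cast hr
  have h := alphaR_eq r hr
  have hp : (0:ℝ) < (r:ℝ) * (r - 1) - 4 := by nlinarith
  by_contra hc
  push Not at hc
  nlinarith

lemma alphaR_le (r : ℕ) (hr : 5 ≤ r) : alphaR r * r ≤ 2 := by
  have h5 : (5:ℝ) ≤ r := by exact_mod_cast hr
  have h := alphaR_eq r hr
  have hp : (0:ℝ) < (r:ℝ) * (r - 1) - 4 := by nlinarith
  by_contra hc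
  push Not at hc
  nlinarith

lemma alphaR_lt_one (r : ℕ) (hr : 5 ≤ r) : alphaR r < 1 := by
  have h5 : (5:ℝ) ≤ r := by exact_mod_cast hr
  have h := alphaR_le r hr
  by_contra hc
  push Not at hc
  nlinarith

lemma sum_ineq (r : ℕ) (hr : 5 ≤ r) (A : Finset ℕ) (s : ℕ → ℕ)
    (h2 : ∀ a ∈ A, 2 ≤ s a) (hle : ∀ a ∈ A, s a < r)
    (hs : (r:ℝ) * (r - 1) - 2 ≤ ∑ a ∈ A, (s a : ℝ) * (s a - 1)) :
    (r : ℝ) + ((A.card : ℝ) - 1) * (2 - alphaR r) ≤ ∑ a ∈ A, (s a : ℝ) := by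
  have hp := alphaR_pos r hr
  have hl := alphaR_le r hr
  have he := alphaR_eq r hr
  have hpt : ∀ a ∈ A, alphaR r / 2 * ((s a : ℝ) * (s a - 1)) ≤ s a + (alphaR r - 2) := by
    intro a ha
    have h2' : (2:ℝ) ≤ s a := by exact_mod_cast h2 a ha
    have h3' : (s a : ℝ) + 1 ≤ r := by exact_mod_cast hle a ha
    have h4 : alphaR r * (s a + 1) ≤ 2 := le_trans (by gcongr) hl
    nlinarith [mul_nonneg (sub_nonneg.2 h2') (sub_nonneg.2 h4)]
  have h := Finset.sum_le_sum hpt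
  rw [← Finset.mul_sum, Finset.sum_add_distrib, Finset.sum_const, nsmul_eq_mul] at h
  have h' : alphaR r / 2 * ((r:ℝ) * (r - 1) - 2) ≤
      alphaR r / 2 * ∑ a ∈ A, (s a : ℝ) * (s a - 1) := by gcongr
  nlinarith

open Classical in
noncomputable def cov {Q : ℕ} (L : ℕ) (A : Finset (Fin Q)) : Finset (Fin Q) :=
  A.biUnion (fun a => Finset.univ.filter (fun p : Fin Q => (a:ℕ) ≤ p ∧ (p:ℕ) ≤ a + L))

lemma card_near {Q : ℕ} (L : ℕ) (a : ℕ) :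
    (Finset.univ.filter (fun p : Fin Q => a ≤ (p:ℕ) ∧ (p:ℕ) ≤ a + L)).card ≤ L + 1 := by
  have : (Finset.univ.filter (fun p : Fin Q => a ≤ (p:ℕ) ∧ (p:ℕ) ≤ a + L)).card
      ≤ (Finset.Icc a (a + L)).card := by
    apply Finset.card_le_card_of_injOn (fun p : Fin Q => (p:ℕ))
    · intro p hp
      simpa using hp
    · intro p _ q _ h
      exact Fin.ext h
  refine this.trans ?_
  simp
  omega

lemma card_near' {Q : ℕ} (L : ℕ) (q : ℕ) :
    (Finset.univ.filter (fun a : Fin Q => (a:ℕ) ≤ q ∧ q ≤ a + L)).card ≤ L + 1 := by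
  have : (Finset.univ.filter (fun a : Fin Q => (a:ℕ) ≤ q ∧ q ≤ a + L)).card
      ≤ (Finset.Icc (q - L) q).card := by
    apply Finset.card_le_card_of_injOn (fun p : Fin Q => (p:ℕ))
    · intro p hp
      simp at hp ⊢
      omega
    · intro p _ q _ h
      exact Fin.ext h
  refine this.trans ?_
  simp
  omega

lemma card_cov {Q : ℕ} (L : ℕ) (A : Finset (Fin Q)) : (cov L A).card ≤ A.card * (L + 1) := by
  unfold cov
  exact Finset.card_biUnion_le_card_mul _ _ _ (fun a _ => card_near L a)

open Classical in
lemma count_E {Q : ℕ} (L K c : ℕ) (hc : c < K) (q : Fin Q) :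
    (Finset.univ.filter (fun E : Finset (Fin Q × Fin Q) =>
      ∃ A : Finset (Fin Q), A.card = c + 1 ∧ q ∈ cov L A ∧ E ⊆ cov L A ×ˢ cov L A)).card ≤
      ((L + 1) * 2 ^ ((K * (L + 1)) * (K * (L + 1)))) * Q ^ c := by
  set I := (Finset.univ.filter (fun a : Fin Q => (a:ℕ) ≤ q ∧ (q:ℕ) ≤ a + L)) ×ˢ
    Finset.powersetCard c (Finset.univ : Finset (Fin Q)) with hI
  have hsub : (Finset.univ.filter (fun E : Finset (Fin Q × Fin Q) =>
      ∃ A : Finset (Fin Q), A.card = c + 1 ∧ q ∈ cov L A ∧ E ⊆ cov L A ×ˢ cov L A)) ⊆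
      I.biUnion (fun z => (cov L (insert z.1 z.2) ×ˢ cov L (insert z.1 z.2)).powerset) := by
    intro E hE
    simp only [Finset.mem_filter, Finset.mem_univ, true_and] at hE
    obtain ⟨A, hA, hq, hE⟩ := hE
    have hq' := hq
    simp only [cov, Finset.mem_biUnion, Finset.mem_filter, Finset.mem_univ, true_and] at hq'
    obtain ⟨a, haA, ha⟩ := hq'
    rw [Finset.mem_biUnion]
    refine ⟨(a, A.erase a), ?_, ?_⟩
    · simp only [hI, Finset.mem_product, Finset.mem_filter, Finset.mem_univ, true_and,
        Finset.mem_powersetCard, Finset.subset_univ]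
      refine ⟨ha, ?_⟩
      rw [Finset.card_erase_of_mem haA]; omega
    · simp only [Finset.mem_powerset, Finset.insert_erase haA]
      exact hE
  refine (Finset.card_le_card hsub).trans ?_
  have hb := Finset.card_biUnion_le_card_mul I
    (fun z => (cov L (insert z.1 z.2) ×ˢ cov L (insert z.1 z.2)).powerset)
    (2 ^ ((K * (L + 1)) * (K * (L + 1)))) (by
      rintro ⟨a, A⟩ hz
      simp only [hI, Finset.mem_product, Finset.mem_powersetCard] at hz
      rw [Finset.card_powerset, Finset.card_product]
      have h1 : (cov L (insert a A)).card ≤ K * (L + 1) := by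
        refine (card_cov L _).trans ?_
        apply Nat.mul_le_mul_right
        refine (Finset.card_insert_le _ _).trans ?_
        rw [hz.2.2]; omega
      exact Nat.pow_le_pow_right (by norm_num) (Nat.mul_le_mul h1 h1))
  refine hb.trans ?_
  have hIc : I.card ≤ (L + 1) * Q ^ c := by
    rw [hI, Finset.card_product, Finset.card_powersetCard, Finset.card_univ, Fintype.card_fin]
    exact Nat.mul_le_mul (card_near' L q) (Nat.choose_le_pow Q c)
  calc _ ≤ ((L + 1) * Q ^ c) * 2 ^ ((K * (L + 1)) * (K * (L + 1))) := Nat.mul_le_mul_right _ hIc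
    _ = _ := by ring

open Classical in
lemma exists_x (β : ℝ) (hβ : 0 ≤ β) (K L : ℕ) (C : ℝ) :
    ∃ n₀ : ℕ, ∀ n : ℕ, n₀ ≤ n → ∀ Q : ℕ, (Q : ℝ) ≤ C * (n : ℝ) ^ β →
      ∃ x : ℕ → Fin n, ∀ A P : Finset ℕ, A.Nonempty → A.card ≤ K → P.card ≤ K →
        A ⊆ Finset.range Q → P ⊆ Finset.range Q →
        (∀ p ∈ P, ∃ a ∈ A, a ≤ p ∧ p ≤ a + L) →
        (P.card : ℝ) ≤ (P.image x).card + ((A.card : ℝ) - 1) * β := by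
  obtain ⟨n₀, hn₀⟩ := analytic_bound β K C
    (((L + 1) * 2 ^ ((K * (L + 1)) * (K * (L + 1))) : ℕ) : ℝ) (by positivity)
  refine ⟨max n₀ 1, fun n hn Q hQ => ?_⟩
  have hn1 : n₀ ≤ n := le_trans (le_max_left _ _) hn
  have hn2 : 0 < n := le_trans (le_max_right _ _) hn
  have hbd := hn₀ n hn1 Q (by positivity) hQ
  set F : Finset (Finset (Fin Q × Fin Q)) := Finset.univ.filter (fun E =>
    Set.InjOn Prod.fst (E : Set (Fin Q × Fin Q)) ∧ (∀ e ∈ E, ∀ e' ∈ E, e.1 ≠ e'.2) ∧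
    E.card ≤ K ∧ ∃ c < K, (c : ℝ) * β < E.card ∧
      ∃ A : Finset (Fin Q), A.card = c + 1 ∧ eSupp E ⊆ cov L A) with hF
  have hFm : ∀ E, E ∈ F ↔ (Set.InjOn Prod.fst (E : Set (Fin Q × Fin Q)) ∧
    (∀ e ∈ E, ∀ e' ∈ E, e.1 ≠ e'.2) ∧
    E.card ≤ K ∧ ∃ c < K, (c : ℝ) * β < E.card ∧
      ∃ A : Finset (Fin Q), A.card = c + 1 ∧ eSupp E ⊆ cov L A) := by
    intro E; simp [hF]
  obtain ⟨y, hy⟩ := lll n hn2 F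
    (by
      intro E hE
      obtain ⟨-, -, -, c, -, hc, -⟩ := (hFm E).1 hE
      rw [← Finset.card_pos]
      have : (0:ℝ) < E.card := lt_of_le_of_lt (by positivity) hc
      exact_mod_cast this)
    (fun E hE => ((hFm E).1 hE).1) (fun E hE => ((hFm E).1 hE).2.1)
    (by
      intro q
      have hex : ∀ E : Finset (Fin Q × Fin Q), ∃ c : ℕ, E ∈ F → c < K ∧ (c : ℝ) * β < E.card ∧
        ∃ A : Finset (Fin Q), A.card = c + 1 ∧ eSupp E ⊆ cov L A := by
        intro E
        by_cases hE : E ∈ F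
        · obtain ⟨c, hc⟩ := ((hFm E).1 hE).2.2.2
          exact ⟨c, fun _ => hc⟩
        · exact ⟨0, fun h => absurd h hE⟩
      choose cf hcf using hex
      have hmaps : ∀ E ∈ F.filter (fun E => q ∈ eSupp E),
          ((cf E, E.card) : ℕ × ℕ) ∈ Finset.range K ×ˢ Finset.range (K + 1) := by
        intro E hE
        have hE := (Finset.mem_filter.1 hE).1
        have h1 := (hcf E hE).1
        have h2 := ((hFm E).1 hE).2.2.1
        simp only [Finset.mem_product, Finset.mem_range]
        omega
      rw [← Finset.sum_fiberwise_of_maps_to hmaps]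
      calc _ ≤ ∑ z ∈ Finset.range K ×ˢ Finset.range (K + 1), (1:ℝ) / (2 * (K + 1) ^ 2) := by
            apply Finset.sum_le_sum
            rintro ⟨c, d⟩ hz
            simp only [Finset.mem_product, Finset.mem_range] at hz
            set G := (F.filter (fun E => q ∈ eSupp E)).filter
              (fun E => ((cf E, E.card) : ℕ × ℕ) = (c, d)) with hG
            have hGs : ∀ E ∈ G, E.card = d := by
              intro E hE
              have := (Finset.mem_filter.1 hE).2
              exact (Prod.mk.inj this).2
            rw [Finset.sum_congr rfl (fun E hE => by rw [hGs E hE] :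
              ∀ E ∈ G, (2 / (n:ℝ)) ^ E.card = (2 / (n:ℝ)) ^ d), Finset.sum_const, nsmul_eq_mul]
            by_cases hGe : G.Nonempty
            · obtain ⟨E₀, hE₀⟩ := hGe
              have hcd : (c:ℝ) * β < d := by
                have h1 := Finset.mem_filter.1 hE₀
                have h2 := (hcf E₀ (Finset.mem_filter.1 h1.1).1).2.1
                have h3 := Prod.mk.inj h1.2
                rw [h3.1, h3.2] at h2
                exact h2
              have hcard : G.card ≤
                  ((L + 1) * 2 ^ ((K * (L + 1)) * (K * (L + 1)))) * Q ^ c := by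
                refine le_trans (Finset.card_le_card ?_) (count_E L K c hz.1 q)
                intro E hE
                have h1 := Finset.mem_filter.1 hE
                have h1' := Finset.mem_filter.1 h1.1
                obtain ⟨A, hA, hs⟩ := (hcf E h1'.1).2.2
                rw [(Prod.mk.inj h1.2).1] at hA
                simp only [Finset.mem_filter, Finset.mem_univ, true_and]
                refine ⟨A, hA, hs h1'.2, ?_⟩
                intro e he
                rw [Finset.mem_product]
                exact ⟨hs (Finset.mem_union_left _ (Finset.mem_image_of_mem _ he)),
                  hs (Finset.mem_union_right _ (Finset.mem_image_of_mem _ he))⟩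
              have hcard' : (G.card : ℝ) ≤
                  (((L + 1) * 2 ^ ((K * (L + 1)) * (K * (L + 1))) : ℕ) : ℝ) * (Q:ℝ) ^ c := by
                exact_mod_cast hcard
              exact le_trans (mul_le_mul_of_nonneg_right hcard' (by positivity))
                (hbd c hz.1 d (by omega) hcd)
            · rw [Finset.not_nonempty_iff_eq_empty] at hGe
              rw [hGe]
              simp
              positivity
        _ ≤ 1 / 2 := by
            rw [Finset.sum_const, Finset.card_product, Finset.card_range, Finset.card_range,
              nsmul_eq_mul, mul_one_div, div_le_div_iff₀ (by positivity) (by norm_num)]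
            push_cast
            nlinarith [(Nat.cast_nonneg K : (0:ℝ) ≤ K)])
  refine ⟨fun p => if h : p < Q then y ⟨p, h⟩ else ⟨0, hn2⟩, ?_⟩
  intro A P hA hAK hPK hAQ hPQ hcov
  set x : ℕ → Fin n := fun p => if h : p < Q then y ⟨p, h⟩ else ⟨0, hn2⟩ with hx
  by_contra hcon
  push Not at hcon
  have hxy : ∀ p : Fin Q, x p = y p := by
    intro p; simp [hx]
  -- lift to Fin Q
  have hP' : ∃ P' : Finset (Fin Q), P'.map Fin.valEmbedding = P := by
    refine ⟨Finset.univ.filter (fun p => (p:ℕ) ∈ P), ?_⟩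
    ext p
    simp only [Finset.mem_map, Finset.mem_filter, Finset.mem_univ, true_and, Fin.valEmbedding_apply]
    constructor
    · rintro ⟨a, ha, rfl⟩; exact ha
    · intro hp; exact ⟨⟨p, Finset.mem_range.1 (hPQ hp)⟩, hp, rfl⟩
  have hA' : ∃ A' : Finset (Fin Q), A'.map Fin.valEmbedding = A := by
    refine ⟨Finset.univ.filter (fun p => (p:ℕ) ∈ A), ?_⟩
    ext p
    simp only [Finset.mem_map, Finset.mem_filter, Finset.mem_univ, true_and, Fin.valEmbedding_apply]
    constructor
    · rintro ⟨a, ha, rfl⟩; exact ha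
    · intro hp; exact ⟨⟨p, Finset.mem_range.1 (hAQ hp)⟩, hp, rfl⟩
  obtain ⟨P', rfl⟩ := hP'
  obtain ⟨A', rfl⟩ := hA'
  have himg : (P'.map Fin.valEmbedding).image x = P'.image y := by
    rw [Finset.map_eq_image, Finset.image_image]
    apply Finset.image_congr
    intro p _
    exact hxy p
  rw [himg, Finset.card_map, Finset.card_map] at hcon
  rw [Finset.card_map] at hPK hAK
  have hcovP : P' ⊆ cov L A' := by
    intro p hp
    obtain ⟨a, ha, h⟩ := hcov p (Finset.mem_map_of_mem Fin.valEmbedding hp)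
    obtain ⟨a', ha', rfl⟩ := Finset.mem_map.1 ha
    simp only [cov, Finset.mem_biUnion, Finset.mem_filter, Finset.mem_univ, true_and]
    exact ⟨a', ha', h⟩
  have hA0 : 0 < A'.card := by
    have := Finset.card_pos.2 hA
    rwa [Finset.card_map] at this
  obtain ⟨R, hRP, hRimg, hRinj⟩ : ∃ R ⊆ P', R.image y = P'.image y ∧ Set.InjOn y R := by
    obtain ⟨R, hR1, hR2, hR3⟩ := Finset.exists_subset_injOn_image_eq_of_surjOn P' (P'.image y) (f := y) (by
      rw [Finset.coe_image]; exact Set.surjOn_image _ _)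
    exact ⟨R, hR1, hR3, hR2⟩
  have hrho : ∀ p : Fin Q, ∃ p' : Fin Q, p ∈ P' → p' ∈ R ∧ y p' = y p := by
    intro p
    by_cases hp : p ∈ P'
    · have : y p ∈ R.image y := by rw [hRimg]; exact Finset.mem_image_of_mem _ hp
      obtain ⟨p', h1, h2⟩ := Finset.mem_image.1 this
      exact ⟨p', fun _ => ⟨h1, h2⟩⟩
    · exact ⟨p, fun h => absurd h hp⟩
  choose ρ hρ using hrho
  set E : Finset (Fin Q × Fin Q) := (P' \ R).image (fun p => (p, ρ p)) with hE
  have hEm : ∀ e ∈ E, e.1 ∈ P' ∧ e.1 ∉ R ∧ e.2 = ρ e.1 ∧ e.2 ∈ R ∧ y e.2 = y e.1 := by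
    intro e he
    obtain ⟨p, hp, rfl⟩ := Finset.mem_image.1 he
    rw [Finset.mem_sdiff] at hp
    exact ⟨hp.1, hp.2, rfl, (hρ p hp.1).1, (hρ p hp.1).2⟩
  have hEcard : E.card + (P'.image y).card = P'.card := by
    rw [hE, Finset.card_image_of_injective _ (fun a b h => (Prod.mk.inj h).1), ← hRimg,
      Finset.card_image_of_injOn hRinj]
    exact Finset.card_sdiff_add_card_eq_card hRP
  have hEF : E ∈ F := by
    rw [hFm]
    refine ⟨?_, ?_, by omega, A'.card - 1, by omega, ?_, A', by omega, ?_⟩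
    · intro e he e' he' h
      have h1 := (hEm e he).2.2.1
      have h2 := (hEm e' he').2.2.1
      exact Prod.ext h (by rw [h1, h2, h])
    · intro e he e' he' h
      apply (hEm e he).2.1
      rw [h]; exact (hEm e' he').2.2.2.1
    · rw [Nat.cast_sub (by omega), Nat.cast_one]
      have : (E.card : ℝ) + (P'.image y).card = P'.card := by exact_mod_cast hEcard
      linarith
    · intro v hv
      apply hcovP
      rcases Finset.mem_union.1 hv with h | h
      · obtain ⟨e, he, rfl⟩ := Finset.mem_image.1 h
        exact (hEm e he).1
      · obtain ⟨e, he, rfl⟩ := Finset.mem_image.1 h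
        exact hRP (hEm e he).2.2.2.1
  obtain ⟨e, he, hne⟩ := hy E hEF
  exact hne (hEm e he).2.2.2.2.symm

def win (r i : ℕ) : Finset ℕ := Finset.Ico ((r - 2) * i) ((r - 2) * i + r)

lemma mem_win {r i p : ℕ} : p ∈ win r i ↔ (r - 2) * i ≤ p ∧ p < (r - 2) * i + r := by
  simp [win]

lemma card_win (r i : ℕ) : (win r i).card = r := by simp [win]

lemma win_step {r i j : ℕ} (h : i < j) : (r - 2) * i + (r - 2) ≤ (r - 2) * j := by
  have := Nat.mul_le_mul_left (r - 2) (Nat.succ_le_of_lt h)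
  rw [Nat.succ_eq_add_one, Nat.mul_add, Nat.mul_one] at this
  exact this

lemma win_inter_succ {r : ℕ} (hr : 5 ≤ r) (i : ℕ) : (win r i ∩ win r (i + 1)).card = 2 := by
  have : win r i ∩ win r (i + 1) = Finset.Ico ((r - 2) * (i + 1)) ((r - 2) * (i + 1) + 2) := by
    ext p
    simp only [Finset.mem_inter, mem_win, Finset.mem_Ico, Nat.mul_add, Nat.mul_one]
    omega
  rw [this]; simp

lemma win_disj {r : ℕ} (hr : 5 ≤ r) {i j p : ℕ} (h : i + 1 < j) (h1 : p ∈ win r i)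
    (h2 : p ∈ win r j) : False := by
  rw [mem_win] at h1 h2
  have a1 := win_step (r := r) (lt_add_one i)
  have a2 := win_step (r := r) h
  omega

lemma win_inter_lt {r : ℕ} (hr : 5 ≤ r) {i j : ℕ} (h : i < j) : (win r i ∩ win r j).card ≤ 2 := by
  rcases Nat.lt_or_ge (i + 1) j with h' | h'
  · have : win r i ∩ win r j = ∅ := by
      rw [Finset.eq_empty_iff_forall_notMem]
      intro p hp
      rw [Finset.mem_inter] at hp
      exact win_disj hr h' hp.1 hp.2
    rw [this]; simp
  · have : j = i + 1 := by omega
    rw [this, win_inter_succ hr]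

lemma win_inter_ne {r : ℕ} (hr : 5 ≤ r) {i j : ℕ} (h : i ≠ j) : (win r i ∩ win r j).card ≤ 2 := by
  rcases lt_or_gt_of_ne h with h | h
  · exact win_inter_lt hr h
  · rw [Finset.inter_comm]; exact win_inter_lt hr h

lemma win_convex {r i m M : ℕ} {R : Finset ℕ} (hm : m ∈ win r i) (hM : M ∈ win r i)
    (h : ∀ p ∈ R, m ≤ p ∧ p ≤ M) : R ⊆ win r i := by
  intro p hp
  have := h p hp
  rw [mem_win] at *
  omega

lemma det_lemma {r T : ℕ} (hr : 5 ≤ r) (R : Finset ℕ) (hR : R.card = r) (p₀ q₀ : ℕ)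
    (h : ∀ p ∈ R, ∀ q ∈ R, p ≠ q → ¬((p = p₀ ∧ q = q₀) ∨ (p = q₀ ∧ q = p₀)) →
      ∃ i, 1 ≤ i ∧ i ≤ T ∧ p ∈ win r i ∧ q ∈ win r i) :
    ∃ i, 1 ≤ i ∧ i ≤ T ∧ R ⊆ win r i := by
  have hne : R.Nonempty := Finset.card_pos.1 (by omega)
  obtain ⟨m, hm, hmin⟩ := R.exists_min_image id hne
  obtain ⟨M, hM, hmax⟩ := R.exists_max_image id hne
  simp only [id] at hmin hmax
  have hmM : m ≠ M := by
    intro he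
    have : R ⊆ {m} := by
      intro p hp
      rw [Finset.mem_singleton]
      exact le_antisymm (he ▸ hmax p hp) (hmin p hp)
    have := Finset.card_le_card this
    simp at this; omega
  by_cases hex : (m = p₀ ∧ M = q₀) ∨ (m = q₀ ∧ M = p₀)
  · have c1 : (R.erase m).card = r - 1 := by rw [Finset.card_erase_of_mem hm, hR]
    have c2 : (R.erase M).card = r - 1 := by rw [Finset.card_erase_of_mem hM, hR]
    obtain ⟨m1, hm1, hmin1⟩ := (R.erase m).exists_min_image id (Finset.card_pos.1 (by omega))
    obtain ⟨M2, hM2, hmax2⟩ := (R.erase M).exists_max_image id (Finset.card_pos.1 (by omega))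
    simp only [id] at hmin1 hmax2
    have hMR1 : M ∈ R.erase m := Finset.mem_erase.2 ⟨hmM.symm, hM⟩
    have hmR2 : m ∈ R.erase M := Finset.mem_erase.2 ⟨hmM, hm⟩
    have hm1' := Finset.mem_erase.1 hm1
    have hM2' := Finset.mem_erase.1 hM2
    have hm1M : m1 ≠ M := by
      intro he
      have : R.erase m ⊆ {M} := by
        intro p hp
        rw [Finset.mem_singleton]
        exact le_antisymm (hmax p (Finset.mem_of_mem_erase hp)) (he ▸ hmin1 p hp)
      have := Finset.card_le_card this
      simp at this; omega
    have hmM2 : m ≠ M2 := by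
      intro he
      have : R.erase M ⊆ {m} := by
        intro p hp
        rw [Finset.mem_singleton]
        exact le_antisymm (he ▸ hmax2 p hp) (hmin p (Finset.mem_of_mem_erase hp))
      have := Finset.card_le_card this
      simp at this; omega
    obtain ⟨j, hj1, hjT, hj2, hj3⟩ := h m1 hm1'.2 M hM hm1M (by omega)
    obtain ⟨i, hi1, hiT, hi2, hi3⟩ := h m hm M2 hM2'.2 hmM2 (by omega)
    have s1 : R.erase m ⊆ win r j := win_convex hj2 hj3
      (fun p hp => ⟨hmin1 p hp, hmax p (Finset.mem_of_mem_erase hp)⟩)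
    have s2 : R.erase M ⊆ win r i := win_convex hi2 hi3
      (fun p hp => ⟨hmin p (Finset.mem_of_mem_erase hp), hmax2 p hp⟩)
    by_cases hij : i = j
    · refine ⟨i, hi1, hiT, ?_⟩
      subst hij
      intro p hp
      by_cases hpm : p = m
      · subst hpm; exact hi2
      · exact s1 (Finset.mem_erase.2 ⟨hpm, hp⟩)
    · exfalso
      have h1 := win_inter_ne hr hij
      have h2 : (R.erase m).erase M ⊆ win r i ∩ win r j := by
        intro p hp
        have h3 := Finset.mem_erase.1 hp
        have h4 := Finset.mem_erase.1 h3.2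
        exact Finset.mem_inter.2 ⟨s2 (Finset.mem_erase.2 ⟨h3.1, h4.2⟩), s1 h3.2⟩
      have h3 := Finset.card_le_card h2
      rw [Finset.card_erase_of_mem hMR1, c1] at h3
      omega
  · obtain ⟨i, hi1, hiT, h2, h3⟩ := h m hm M hM hmM hex
    exact ⟨i, hi1, hiT, win_convex h2 h3 (fun p hp => ⟨hmin p hp, hmax p hp⟩)⟩

def Sparse {n : ℕ} (β : ℝ) (K L Q : ℕ) (x : ℕ → Fin n) : Prop :=
  ∀ A P : Finset ℕ, A.Nonempty → A.card ≤ K → P.card ≤ K →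
        A ⊆ Finset.range Q → P ⊆ Finset.range Q →
        (∀ p ∈ P, ∃ a ∈ A, a ≤ p ∧ p ≤ a + L) →
        (P.card : ℝ) ≤ (P.image x).card + ((A.card : ℝ) - 1) * β

lemma sparse_inj {n : ℕ} {β : ℝ} {K L Q : ℕ} {x : ℕ → Fin n} (hK : 4 ≤ K)
    (hx : Sparse β K L Q x) {p q : ℕ} (hp : p < Q) (hq : q < Q) (h1 : p ≤ q + L) (h2 : q ≤ p + L)
    (h : x p = x q) : p = q := by
  by_contra hne
  wlog hpq : p ≤ q generalizing p q
  · exact this hq hp h2 h1 h.symm (Ne.symm hne) (by omega)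
  have := hx {p} {p, q} (by simp) (by simp; omega) (by rw [Finset.card_pair hne]; omega)
    (by simpa using hp) (by
      intro v hv
      simp only [Finset.mem_insert, Finset.mem_singleton] at hv
      rw [Finset.mem_range]; omega) (by
      intro v hv
      simp only [Finset.mem_insert, Finset.mem_singleton] at hv
      exact ⟨p, by simp, by omega, by omega⟩)
  rw [Finset.card_pair hne] at this
  have h3 : ({p, q} : Finset ℕ).image x = {x p} := by
    rw [Finset.image_insert, Finset.image_singleton, h]; simp
  rw [h3] at this
  norm_num at this

lemma sparse_pair {n : ℕ} {β : ℝ} {K L Q : ℕ} {x : ℕ → Fin n} (hK : 4 ≤ K) (hβ0 : 0 ≤ β)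
    (hβ : β < 2) (hx : Sparse β K (2 * L) Q x) {p q p' q' : ℕ} (hp : p < Q) (hq : q < Q)
    (hp' : p' < Q) (hq' : q' < Q) (h1 : p ≤ q + L) (h2 : q ≤ p + L)
    (h1' : p' ≤ q' + L) (h2' : q' ≤ p' + L)
    (hne : p ≠ q) (h : x p = x p') (h' : x q = x q') : p = p' ∧ q = q' := by
  have hxne : x p ≠ x q := fun he => hne (sparse_inj hK hx hp hq (by omega) (by omega) he)
  have hne' : p' ≠ q' := by
    rintro rfl
    exact hxne (h.trans h'.symm)
  by_cases e1 : p = p'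
  · refine ⟨e1, sparse_inj hK hx hq hq' (by omega) (by omega) h'⟩
  by_cases e2 : q = q'
  · refine ⟨sparse_inj hK hx hp hp' (by omega) (by omega) h, e2⟩
  exfalso
  have e3 : p ≠ q' := by
    rintro rfl
    exact hxne h'.symm
  have e4 : q ≠ p' := by
    rintro rfl
    exact hxne h
  have hcard : ({p, q, p', q'} : Finset ℕ).card = 4 := by
    rw [Finset.card_insert_of_notMem (by simp; omega), Finset.card_insert_of_notMem (by simp; omega),
      Finset.card_pair hne']
  have hA : ({min p q, min p' q'} : Finset ℕ).card ≤ 2 := Finset.card_le_two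
  have := hx {min p q, min p' q'} {p, q, p', q'} (by simp) (by omega) (by omega)
    (by
      intro v hv
      simp only [Finset.mem_insert, Finset.mem_singleton] at hv
      rw [Finset.mem_range]; omega)
    (by
      intro v hv
      simp only [Finset.mem_insert, Finset.mem_singleton] at hv
      rw [Finset.mem_range]; omega)
    (by
      intro v hv
      simp only [Finset.mem_insert, Finset.mem_singleton] at hv
      by_cases hv' : v = p ∨ v = q
      · exact ⟨min p q, by simp, by omega, by omega⟩
      · exact ⟨min p' q', by simp, by omega, by omega⟩)
  have h3 : (({p, q, p', q'} : Finset ℕ).image x).card ≤ 2 := by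
    have : ({p, q, p', q'} : Finset ℕ).image x ⊆ {x p, x q} := by
      intro v hv
      rw [Finset.mem_image] at hv
      obtain ⟨t, ht, rfl⟩ := hv
      simp only [Finset.mem_insert, Finset.mem_singleton] at ht ⊢
      rcases ht with rfl | rfl | rfl | rfl
      · exact Or.inl rfl
      · exact Or.inr rfl
      · exact Or.inl h.symm
      · exact Or.inr h'.symm
    exact (Finset.card_le_card this).trans Finset.card_le_two
  rw [hcard] at this
  have h3' : ((({p, q, p', q'} : Finset ℕ).image x).card : ℝ) ≤ 2 := by exact_mod_cast h3
  have hA' : ((({min p q, min p' q'} : Finset ℕ).card : ℕ) : ℝ) ≤ 2 := by exact_mod_cast hA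
  push_cast at this
  nlinarith

lemma sparse_chain {n r T : ℕ} (hr : 5 ≤ r) {β : ℝ} {K L Q : ℕ} {x : ℕ → Fin n} (hK : 4 ≤ K)
    (hβ0 : 0 ≤ β) (hβ : β < 2) (hx : Sparse β K (2 * L) Q x) (hL : r ≤ L)
    (hwin : ∀ i ≤ T, ∀ p ∈ win r i, p < Q) :
    IsKrChain r T (fun i => (win r i).image x) := by
  refine ⟨?_, ?_⟩
  · intro i _ hi
    show ((win r i).image x).card = r
    rw [Finset.card_image_of_injOn, card_win]
    intro p hp q hq h
    rw [Finset.mem_coe] at hp hq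
    have a1 := mem_win.1 hp
    have a2 := mem_win.1 hq
    exact sparse_inj hK hx (hwin i hi p hp) (hwin i hi q hq) (by omega) (by omega) h
  · intro i j _ hij hj
    refine ⟨?_, ?_⟩
    · rintro rfl
      show ((win r i).image x ∩ (win r (i+1)).image x).card = 2
      have hclose : ∀ p, p ∈ win r i ∨ p ∈ win r (i+1) →
          p < Q ∧ (r - 2) * i ≤ p ∧ p < (r - 2) * i + 2 * r := by
        intro p hp
        rcases hp with hp | hp
        · have := mem_win.1 hp
          exact ⟨hwin i (by omega) p hp, by omega, by omega⟩
        · have := mem_win.1 hp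
          rw [Nat.mul_add, Nat.mul_one] at this
          exact ⟨hwin _ hj p hp, by omega, by omega⟩
      have hinj : Set.InjOn x ((win r i : Set ℕ) ∪ (win r (i+1) : Set ℕ)) := by
        intro p hp q hq h
        have a1 := hclose p (by simpa using hp)
        have a2 := hclose q (by simpa using hq)
        exact sparse_inj hK hx a1.1 a2.1 (by omega) (by omega) h
      rw [← Finset.image_inter_of_injOn _ _ hinj, Finset.card_image_of_injOn, win_inter_succ hr]
      apply hinj.mono
      intro p hp
      rw [Finset.mem_coe, Finset.mem_inter] at hp
      exact Or.inl hp.1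
    · intro hne
      show ((win r i).image x ∩ (win r j).image x).card ≤ 1
      by_contra hc
      push Not at hc
      obtain ⟨u, v, hu, hv, huv⟩ := Finset.one_lt_card_iff.1 hc
      rw [Finset.mem_inter, Finset.mem_image, Finset.mem_image] at hu hv
      obtain ⟨⟨p, hp, hpu⟩, ⟨p', hp', hpu'⟩⟩ := hu
      obtain ⟨⟨q, hq, hqv⟩, ⟨q', hq', hqv'⟩⟩ := hv
      have a1 := mem_win.1 hp
      have a2 := mem_win.1 hq
      have a3 := mem_win.1 hp'
      have a4 := mem_win.1 hq'
      have := sparse_pair hK hβ0 hβ hx (hwin i (by omega) p hp) (hwin i (by omega) q hq)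
        (hwin j hj p' hp') (hwin j hj q' hq') (by omega) (by omega) (by omega) (by omega)
        (by rintro rfl; exact huv (hpu.symm.trans hqv)) (hpu.trans hpu'.symm) (hqv.trans hqv'.symm)
      rw [← this.1] at hp'
      exact win_disj hr (by omega) hp hp'

lemma sparse_noExternal {n r T : ℕ} (hr : 5 ≤ r) {β : ℝ} {K L Q : ℕ} {x : ℕ → Fin n}
    (hK : 2 * (r * r) ≤ K) (hβ0 : 0 ≤ β) (hβ : β < 2 - alphaR r)
    (hx : Sparse β K (2 * L) Q x) (hL : r * K ≤ L)
    (hwin : ∀ i ≤ T, ∀ p ∈ win r i, p < Q) :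
    ¬ HasExternalKrMinus r T (fun i => (win r i).image x) := by
  have hK4 : 4 ≤ K := by nlinarith
  have hrL : r ≤ L := by nlinarith
  have hβ2 : β < 2 := by have := alphaR_pos r hr; linarith
  rintro ⟨B, hB, hBne, x₀, hx₀, y₀, hy₀, hxy, hcov⟩
  have hch : ∀ z : Fin n × Fin n, ∃ w : ℕ × ℕ × ℕ, z.1 ∈ B → z.2 ∈ B → z.1 ≠ z.2 →
      ¬((z.1 = x₀ ∧ z.2 = y₀) ∨ (z.1 = y₀ ∧ z.2 = x₀)) →
      1 ≤ w.1 ∧ w.1 ≤ T ∧ w.2.1 ∈ win r w.1 ∧ w.2.2 ∈ win r w.1 ∧ x w.2.1 = z.1 ∧ x w.2.2 = z.2 := by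
    intro z
    by_cases hz : z.1 ∈ B ∧ z.2 ∈ B ∧ z.1 ≠ z.2 ∧
      ¬((z.1 = x₀ ∧ z.2 = y₀) ∨ (z.1 = y₀ ∧ z.2 = x₀))
    · obtain ⟨i, h1, h2, hu, hv⟩ := hcov z.1 hz.1 z.2 hz.2.1 hz.2.2.1 hz.2.2.2
      obtain ⟨p, hp, hpu⟩ := Finset.mem_image.1 hu
      obtain ⟨q, hq, hqv⟩ := Finset.mem_image.1 hv
      exact ⟨(i, p, q), fun _ _ _ _ => ⟨h1, h2, hp, hq, hpu, hqv⟩⟩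
    · exact ⟨(0, 0, 0), fun a b c d => absurd ⟨a, b, c, d⟩ hz⟩
  choose w hw using hch
  set S : Finset (Fin n × Fin n) := B.offDiag \ {(x₀, y₀), (y₀, x₀)} with hS
  have hSm : ∀ z, z ∈ S ↔ z.1 ∈ B ∧ z.2 ∈ B ∧ z.1 ≠ z.2 ∧
      ¬((z.1 = x₀ ∧ z.2 = y₀) ∨ (z.1 = y₀ ∧ z.2 = x₀)) := by
    rintro ⟨u, v⟩
    simp only [hS, Finset.mem_sdiff, Finset.mem_offDiag, Finset.mem_insert, Finset.mem_singleton,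
      Prod.mk.injEq, and_assoc]
  have hwS : ∀ z ∈ S, 1 ≤ (w z).1 ∧ (w z).1 ≤ T ∧ (w z).2.1 ∈ win r (w z).1 ∧
      (w z).2.2 ∈ win r (w z).1 ∧ x (w z).2.1 = z.1 ∧ x (w z).2.2 = z.2 := by
    intro z hz
    obtain ⟨a, b, c, d⟩ := (hSm z).1 hz
    exact hw z a b c d
  have hoff : B.offDiag.card = r * r - r := by rw [Finset.offDiag_card, hB]
  have hScard : r * r - r - 2 ≤ S.card := by
    have h1 := Finset.le_card_sdiff ({(x₀, y₀), (y₀, x₀)} : Finset (Fin n × Fin n)) B.offDiag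
    have h2 : ({(x₀, y₀), (y₀, x₀)} : Finset (Fin n × Fin n)).card ≤ 2 := Finset.card_le_two
    rw [hoff, ← hS] at h1
    omega
  have hScard2 : S.card ≤ r * r := by
    refine (Finset.card_le_card Finset.sdiff_subset).trans ?_
    rw [hoff]; omega
  have h5r : 5 * r ≤ r * r := Nat.mul_le_mul_right r hr
  set P : Finset ℕ := S.image (fun z => (w z).2.1) ∪ S.image (fun z => (w z).2.2) with hP
  have hPK : P.card ≤ K := by
    have h1 := Finset.card_union_le (S.image (fun z => (w z).2.1)) (S.image (fun z => (w z).2.2))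
    have h2 := Finset.card_image_le (s := S) (f := fun z => (w z).2.1)
    have h3 := Finset.card_image_le (s := S) (f := fun z => (w z).2.2)
    rw [← hP] at h1
    omega
  have hP1 : ∀ z ∈ S, (w z).2.1 ∈ P := fun z hz =>
    Finset.mem_union_left _ (Finset.mem_image_of_mem (fun z => (w z).2.1) hz)
  have hP2 : ∀ z ∈ S, (w z).2.2 ∈ P := fun z hz =>
    Finset.mem_union_right _ (Finset.mem_image_of_mem (fun z => (w z).2.2) hz)
  have hPcases : ∀ p ∈ P, ∃ z ∈ S, p = (w z).2.1 ∨ p = (w z).2.2 := by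
    intro p hp
    rcases Finset.mem_union.1 hp with h | h
    · obtain ⟨z, hz, rfl⟩ := Finset.mem_image.1 h
      exact ⟨z, hz, Or.inl rfl⟩
    · obtain ⟨z, hz, rfl⟩ := Finset.mem_image.1 h
      exact ⟨z, hz, Or.inr rfl⟩
  have hPQ : ∀ p ∈ P, p < Q := by
    intro p hp
    obtain ⟨z, hz, h⟩ := hPcases p hp
    have := hwS z hz
    rcases h with rfl | rfl
    · exact hwin _ this.2.1 _ this.2.2.1
    · exact hwin _ this.2.1 _ this.2.2.2.1
  have hPB : ∀ p ∈ P, x p ∈ B := by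
    intro p hp
    obtain ⟨z, hz, h⟩ := hPcases p hp
    have := hwS z hz
    have hz' := (hSm z).1 hz
    rcases h with rfl | rfl
    · rw [this.2.2.2.2.1]; exact hz'.1
    · rw [this.2.2.2.2.2]; exact hz'.2.1
  obtain ⟨κ, hκ1, hκ2⟩ := cluster r P
  have hκS : ∀ z ∈ S, κ (w z).2.1 = κ (w z).2.2 ∧ (w z).2.1 ≠ (w z).2.2 := by
    intro z hz
    have h := hwS z hz
    have a1 := mem_win.1 h.2.2.1
    have a2 := mem_win.1 h.2.2.2.1
    refine ⟨?_, ?_⟩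
    · rcases le_total (w z).2.1 (w z).2.2 with hle | hle
      · exact hκ2 _ (hP1 z hz) _ (hP2 z hz) hle (by omega)
      · exact (hκ2 _ (hP2 z hz) _ (hP1 z hz) hle (by omega)).symm
    · intro he
      apply ((hSm z).1 hz).2.2.1
      rw [← h.2.2.2.2.1, ← h.2.2.2.2.2, he]
  set A := P.image κ with hA
  set s : ℕ → ℕ := fun a => (P.filter (fun p => κ p = a)).card with hs
  have hAP : A ⊆ P := by
    intro a ha
    obtain ⟨p, hp, rfl⟩ := Finset.mem_image.1 ha
    exact (hκ1 p hp).1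
  have hsum : P.card = ∑ a ∈ A, s a := Finset.card_eq_sum_card_image κ P
  have hs2 : ∀ a ∈ A, 2 ≤ s a := by
    intro a ha
    obtain ⟨p, hp, hpa⟩ := Finset.mem_image.1 ha
    obtain ⟨z, hz, h⟩ := hPcases p hp
    have hk := hκS z hz
    apply Finset.one_lt_card.2
    refine ⟨(w z).2.1, ?_, (w z).2.2, ?_, hk.2⟩
    · rw [Finset.mem_filter]
      refine ⟨hP1 z hz, ?_⟩
      rcases h with rfl | rfl
      · exact hpa
      · rw [hk.1]; exact hpa
    · rw [Finset.mem_filter]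
      refine ⟨hP2 z hz, ?_⟩
      rcases h with rfl | rfl
      · rw [← hk.1]; exact hpa
      · exact hpa
  have hSpos : 0 < S.card := by omega
  have hAne : A.Nonempty := by
    obtain ⟨z, hz⟩ := Finset.card_pos.1 hSpos
    exact ⟨_, Finset.mem_image_of_mem κ (hP1 z hz)⟩
  have hfib : ∀ p ∈ P, κ p ≤ p ∧ p ≤ κ p + L := by
    intro p hp
    have := hκ1 p hp
    have h2 : r * P.card ≤ r * K := Nat.mul_le_mul_left r hPK
    exact ⟨this.2.1, by omega⟩
  have hstar := hx A P hAne ((Finset.card_le_card hAP).trans hPK) hPK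
    (fun a ha => Finset.mem_range.2 (hPQ a (hAP ha))) (fun a ha => Finset.mem_range.2 (hPQ a ha))
    (by
      intro p hp
      refine ⟨κ p, Finset.mem_image_of_mem _ hp, ?_⟩
      have := hfib p hp
      omega)
  have himg : (P.image x).card ≤ r := by
    rw [← hB]
    apply Finset.card_le_card
    intro v hv
    obtain ⟨p, hp, rfl⟩ := Finset.mem_image.1 hv
    exact hPB p hp
  have himg' : ((P.image x).card : ℝ) ≤ r := by exact_mod_cast himg
  by_cases hbig : ∀ a ∈ A, s a < r
  · have hpairs : S.card ≤ ∑ a ∈ A, (s a * s a - s a) := by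
      have h1 : S.card ≤ (A.biUnion (fun a => (P.filter (fun p => κ p = a)).offDiag)).card := by
        apply Finset.card_le_card_of_injOn (fun z => ((w z).2.1, (w z).2.2))
        · intro z hz
          rw [Finset.mem_coe] at hz
          have hk := hκS z hz
          simp only [Finset.mem_coe, Finset.mem_biUnion, Finset.mem_offDiag, Finset.mem_filter]
          exact ⟨κ (w z).2.1, Finset.mem_image_of_mem κ (hP1 z hz), ⟨hP1 z hz, rfl⟩,
            ⟨hP2 z hz, hk.1.symm⟩, hk.2⟩
        · intro z hz z' hz' he
          rw [Finset.mem_coe] at hz hz'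
          have h1 := hwS z hz
          have h2 := hwS z' hz'
          have he' := Prod.mk.inj he
          apply Prod.ext
          · rw [← h1.2.2.2.2.1, ← h2.2.2.2.2.1, he'.1]
          · rw [← h1.2.2.2.2.2, ← h2.2.2.2.2.2, he'.2]
      refine h1.trans (Finset.card_biUnion_le.trans ?_)
      apply Finset.sum_le_sum
      intro a _
      rw [Finset.offDiag_card]
    have hcast : (r:ℝ) * (r - 1) - 2 ≤ ∑ a ∈ A, (s a : ℝ) * (s a - 1) := by
      have h1 : ((∑ a ∈ A, (s a * s a - s a) : ℕ) : ℝ) = ∑ a ∈ A, (s a : ℝ) * (s a - 1) := by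
        rw [Nat.cast_sum]
        apply Finset.sum_congr rfl
        intro a _
        rw [Nat.cast_sub (Nat.le_mul_self _)]
        push_cast; ring
      rw [← h1]
      have h2 : r * r ≤ (∑ a ∈ A, (s a * s a - s a)) + r + 2 := by omega
      have h3 : (r:ℝ) * r ≤ ((∑ a ∈ A, (s a * s a - s a) : ℕ) : ℝ) + r + 2 := by exact_mod_cast h2
      linarith
    have hineq := sum_ineq r hr A s hs2 hbig hcast
    have hsum' : (P.card : ℝ) = ∑ a ∈ A, (s a : ℝ) := by rw [hsum]; push_cast; rfl
    rw [← hsum'] at hineq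
    have hA1 : (1:ℝ) ≤ A.card := by exact_mod_cast Finset.card_pos.2 hAne
    have hAle : (A.card : ℝ) ≤ 1 := by
      by_contra hc
      push Not at hc
      nlinarith
    have hA1' : A.card = 1 := by
      have : (A.card : ℝ) = 1 := le_antisymm hAle hA1
      exact_mod_cast this
    obtain ⟨a, ha⟩ := Finset.card_eq_one.1 hA1'
    rw [ha, Finset.sum_singleton] at hsum
    have hlt := hbig a (by rw [ha]; simp)
    rw [hA1'] at hineq
    have : (r:ℝ) ≤ P.card := by simpa using hineq
    have : r ≤ P.card := by exact_mod_cast this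
    omega
  · push Not at hbig
    obtain ⟨a, ha, hsa⟩ := hbig
    set R := P.filter (fun p => κ p = a) with hR
    have hRm : ∀ p ∈ R, p ∈ P ∧ a ≤ p ∧ p ≤ a + L := by
      intro p hp
      obtain ⟨h1, h2⟩ := Finset.mem_filter.1 hp
      have := hfib p h1
      rw [h2] at this
      exact ⟨h1, this⟩
    have hinj : Set.InjOn x R := by
      intro p hp q hq h
      have h1 := hRm p hp
      have h2 := hRm q hq
      exact sparse_inj hK4 hx (hPQ p h1.1) (hPQ q h2.1) (by omega) (by omega) h
    have hRB : R.image x = B := by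
      apply Finset.eq_of_subset_of_card_le
      · intro v hv
        obtain ⟨p, hp, rfl⟩ := Finset.mem_image.1 hv
        exact hPB p (hRm p hp).1
      · rw [Finset.card_image_of_injOn hinj, hB]; exact hsa
    have hRcard : R.card = r := by rw [← hB, ← hRB, Finset.card_image_of_injOn hinj]
    obtain ⟨p₀, hp₀, hp₀x⟩ := Finset.mem_image.1 (hRB ▸ hx₀ : x₀ ∈ R.image x)
    obtain ⟨q₀, hq₀, hq₀y⟩ := Finset.mem_image.1 (hRB ▸ hy₀ : y₀ ∈ R.image x)
    obtain ⟨i, hi1, hiT, hsub⟩ := det_lemma (T := T) hr R hRcard p₀ q₀ (by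
      intro p hp q hq hpq hex
      have h1 := hRm p hp
      have h2 := hRm q hq
      have hz : (x p, x q) ∈ S := by
        rw [hSm]
        refine ⟨hPB p h1.1, hPB q h2.1, fun he => hpq (hinj hp hq he), ?_⟩
        rintro (⟨h3, h4⟩ | ⟨h3, h4⟩)
        · exact hex (Or.inl ⟨hinj hp hp₀ (h3.trans hp₀x.symm), hinj hq hq₀ (h4.trans hq₀y.symm)⟩)
        · exact hex (Or.inr ⟨hinj hp hq₀ (h3.trans hq₀y.symm), hinj hq hp₀ (h4.trans hp₀x.symm)⟩)
      have h := hwS _ hz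
      have a1 := mem_win.1 h.2.2.1
      have a2 := mem_win.1 h.2.2.2.1
      have hpp := sparse_pair hK4 hβ0 hβ2 hx (hPQ p h1.1) (hPQ q h2.1)
        (hPQ _ (hP1 _ hz)) (hPQ _ (hP2 _ hz)) (by omega) (by omega) (by omega) (by omega) hpq
        h.2.2.2.2.1.symm h.2.2.2.2.2.symm
      have k1 := h.2.2.1
      have k2 := h.2.2.2.1
      generalize (w (x p, x q)) = t at *
      refine ⟨t.1, h.1, h.2.1, ?_, ?_⟩
      · rw [hpp.1]; exact k1
      · rw [hpp.2]; exact k2)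
    apply hBne i hi1 hiT
    have hRw : R = win r i := Finset.eq_of_subset_of_card_le hsub (by rw [card_win, hRcard])
    show B = (win r i).image x
    rw [← hRw, hRB]

lemma core (r : ℕ) (hr : 5 ≤ r) (β : ℝ) (hβ0 : 0 ≤ β) (hβ : β < 2 - alphaR r) :
    ∃ n₀ : ℕ, ∀ n : ℕ, n₀ ≤ n → ∀ T : ℕ, (T : ℝ) ≤ (n : ℝ) ^ β →
      ∃ H : ℕ → Finset (Fin n), IsGoodKrChain r T H := by
  obtain ⟨n₀, hn₀⟩ := exists_x β hβ0 (2 * (r * r)) (2 * (r * (2 * (r * r)))) (2 * r)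
  refine ⟨max n₀ 1, fun n hn T hT => ?_⟩
  have hn1 : n₀ ≤ n := le_trans (le_max_left _ _) hn
  have hn2 : 1 ≤ n := le_trans (le_max_right _ _) hn
  have h1 : (1:ℝ) ≤ (n:ℝ) ^ β := Real.one_le_rpow (by exact_mod_cast hn2) hβ0
  obtain ⟨x, hx⟩ := hn₀ n hn1 (r * T + r) (by
    push_cast
    have : (0:ℝ) ≤ r := by positivity
    nlinarith)
  have hx' : Sparse β (2 * (r * r)) (2 * (r * (2 * (r * r)))) (r * T + r) x := by
    intro A P a b c d e f
    convert hx A P a b c d e f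
  have hwin : ∀ i ≤ T, ∀ p ∈ win r i, p < r * T + r := by
    intro i hi p hp
    have h2 := mem_win.1 hp
    have h3 : (r - 2) * i ≤ r * T := Nat.mul_le_mul (by omega) hi
    omega
  have hβ2 : β < 2 := by have := alphaR_pos r hr; linarith
  refine ⟨fun i => (win r i).image x, ?_, ?_⟩
  · exact sparse_chain hr (by nlinarith) hβ0 hβ2 hx' (by nlinarith) hwin
  · exact sparse_noExternal hr le_rfl hβ0 hβ hx' le_rfl hwin

/-- For `r ≥ 5` and `ε > 0`, if `n` is large enough, there is a good `K_r`-chain with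
`T = ⌊n^(2 - α_r - ε)⌋` cliques using at most `n` vertices in total, where
`α_r = (r-2)/(C(r,2)-2)`. -/
theorem exists_good_chain (r : ℕ) (hr : 5 ≤ r) (ε : ℝ) (hε : 0 < ε) :
    ∃ n₀ : ℕ, ∀ n : ℕ, n₀ ≤ n →
      ∃ H : ℕ → Finset (Fin n),
        IsGoodKrChain r ⌊(n : ℝ) ^ (2 - ((r : ℝ) - 2) / ((r.choose 2 : ℝ) - 2) - ε)⌋₊ H := by
  have ha := alphaR_lt_one r hr
  have hal : ((r : ℝ) - 2) / ((r.choose 2 : ℝ) - 2) = alphaR r := rfl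
  rw [hal]
  obtain ⟨n₀, hn₀⟩ := core r hr (max (2 - alphaR r - ε) 1)
    (le_trans zero_le_one (le_max_right _ _)) (max_lt (by linarith) (by linarith))
  refine ⟨max n₀ 1, fun n hn => ?_⟩
  have hn1 : n₀ ≤ n := le_trans (le_max_left _ _) hn
  have hn2 : (1:ℝ) ≤ n := by exact_mod_cast le_trans (le_max_right _ _) hn
  apply hn₀ n hn1
  refine (Nat.floor_le (by positivity)).trans ?_
  exact Real.rpow_le_rpow_of_exponent_le hn2 (le_max_left _ _)
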